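/- Suppose G is symmetric and i, j, k are three distinct nodes of N. Then the identity m_{ij}^{¬{i,j,k}} · D = m_{ij}·m_{kk} − m_{ik}·m_{jk} holds in ℤ[[x]], where D = m_{ii}·m_{jj}·m_{kk} + 2·m_{ij}·m_{ik}·m_{jk} − m_{ii}·m_{jk}² − m_{ij}²·m_{kk} − m_{ik}²·m_{jj} is the determinant of the submatrix M_{{i,j,k},{i,j,k}}. -/

import Mathlib

/-- The number of length-`t` walks from `i` to `j` in the graph with 0-1 adjacency
matrix `G`. -/
def walkCount {n : ℕ} (G : Matrix (Fin n) (Fin n) ℤ) (i j : Fin n) (t : ℕ) : ℕ :=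
  (Finset.univ.filter fun w : Fin (t + 1) → Fin n =>
    w 0 = i ∧ w (Fin.last t) = j ∧
      ∀ k : Fin t, G (w k.castSucc) (w k.succ) = 1).card

/-- The number of length-`t` walks from `i` to `j` none of whose intermediate nodes
lies in `A`. -/
def walkCountAvoid {n : ℕ} (G : Matrix (Fin n) (Fin n) ℤ) (A : Finset (Fin n))
    (i j : Fin n) (t : ℕ) : ℕ :=
  (Finset.univ.filter fun w : Fin (t + 1) → Fin n =>
    w 0 = i ∧ w (Fin.last t) = j ∧
      (∀ k : Fin t, G (w k.castSucc) (w k.succ) = 1) ∧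
      ∀ k : Fin (t + 1), k ≠ 0 → k ≠ Fin.last t → w k ∉ A).card

/-- `m_{ij}`. -/
noncomputable def mSer {n : ℕ} (G : Matrix (Fin n) (Fin n) ℤ) (i j : Fin n) :
    PowerSeries ℤ :=
  PowerSeries.mk fun t => (walkCount G i j t : ℤ)

/-- `m_{ij}^{¬A}`. -/
noncomputable def mAvoid {n : ℕ} (G : Matrix (Fin n) (Fin n) ℤ) (A : Finset (Fin n))
    (i j : Fin n) : PowerSeries ℤ :=
  PowerSeries.mk fun t => (walkCountAvoid G A i j t : ℤ)

lemma walkCount_eq_walkCountAvoid_empty {n : ℕ} (G : Matrix (Fin n) (Fin n) ℤ) (a b : Fin n)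
    (t : ℕ) : walkCount G a b t = walkCountAvoid G ∅ a b t := by
  simp [walkCount, walkCountAvoid]

lemma walkCountAvoid_zero {n : ℕ} (G : Matrix (Fin n) (Fin n) ℤ) (A : Finset (Fin n))
    (a b : Fin n) : walkCountAvoid G A a b 0 = if a = b then 1 else 0 := by
  unfold walkCountAvoid
  rw [Finset.card_filter, ← Equiv.sum_comp (Equiv.funUnique (Fin 1) (Fin n)).symm]
  have h (x : Fin n) : (x = a ∧ x = b) ↔ (x = a ∧ a = b) := by grind
  simp [h, ite_and, Subsingleton.elim _ (0 : Fin 1)]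

lemma walkCountAvoid_one {n : ℕ} {G : Matrix (Fin n) (Fin n) ℤ}
    (hG : ∀ i j, G i j = 0 ∨ G i j = 1) (A : Finset (Fin n)) (a b : Fin n) :
    (walkCountAvoid G A a b 1 : ℤ) = G a b := by
  unfold walkCountAvoid
  rw [Finset.card_filter, ← Equiv.sum_comp (finTwoArrowEquiv (Fin n)).symm,
    Fintype.sum_prod_type]
  have h (x y : Fin n) : (x = a ∧ y = b ∧ G x y = 1) ↔ (x = a ∧ y = b ∧ G a b = 1) := by grind
  have hlast : Fin.last 1 = 1 := rfl
  rcases hG a b with h2 | h2 <;>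
    simp +contextual [h, h2, ite_and, Fin.forall_fin_two, hlast]

/-- Decomposition of an avoiding walk of length at least two by its last step. -/
lemma walkCountAvoid_add_two {n : ℕ} {G : Matrix (Fin n) (Fin n) ℤ}
    (hG : ∀ i j, G i j = 0 ∨ G i j = 1) (A : Finset (Fin n)) (a b : Fin n) (t : ℕ) :
    (walkCountAvoid G A a b (t + 2) : ℤ) =
      ∑ c, walkCountAvoid G A a c (t + 1) * ((if c ∈ A then 0 else 1) * G c b) := by
  unfold walkCountAvoid
  simp only [Finset.card_filter, Nat.cast_sum, Finset.sum_mul]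
  rw [Finset.sum_comm, ← Equiv.sum_comp (Fin.snocEquiv (fun _ => Fin n)),
    Fintype.sum_prod_type, Finset.sum_comm]
  refine Finset.sum_congr rfl fun v _ => ?_
  have hw (x : Fin n) :
      ((Fin.snocEquiv (fun _ => Fin n) (x, v) : Fin (t + 3) → Fin n) 0 = a ∧
        (Fin.snocEquiv (fun _ => Fin n) (x, v) : Fin (t + 3) → Fin n) (Fin.last (t + 2)) = b ∧
        (∀ k : Fin (t + 2),
          G ((Fin.snocEquiv (fun _ => Fin n) (x, v) : Fin (t + 3) → Fin n) k.castSucc)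
            ((Fin.snocEquiv (fun _ => Fin n) (x, v) : Fin (t + 3) → Fin n) k.succ) = 1) ∧
        ∀ k : Fin (t + 3), k ≠ 0 → k ≠ Fin.last (t + 2) →
          (Fin.snocEquiv (fun _ => Fin n) (x, v) : Fin (t + 3) → Fin n) k ∉ A) ↔
      x = b ∧ (v 0 = a ∧ (∀ k : Fin (t + 1), G (v k.castSucc) (v k.succ) = 1) ∧
        ∀ k : Fin (t + 2), k ≠ 0 → k ≠ Fin.last (t + 1) → v k ∉ A) ∧
        v (Fin.last (t + 1)) ∉ A ∧ G (v (Fin.last (t + 1))) b = 1 := by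
    have h0 : (Fin.snoc v x : Fin (t + 3) → Fin n) 0 = v 0 :=
      Fin.snoc_castSucc (α := fun _ => Fin n) x v 0
    have hsplit : (∀ k : Fin (t + 2), k ≠ 0 → v k ∉ A) ↔
        (∀ k : Fin (t + 2), k ≠ 0 → k ≠ Fin.last (t + 1) → v k ∉ A) ∧
          v (Fin.last (t + 1)) ∉ A := by
      constructor
      · exact fun h => ⟨fun k hk _ => h k hk, h _ (Fin.last_pos).ne'⟩
      · rintro ⟨h, hl⟩ k hk
        by_cases hkl : k = Fin.last (t + 1)
        · rwa [hkl]
        · exact h k hk hkl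
    have havoid : (∀ k : Fin (t + 3), k ≠ 0 → k ≠ Fin.last (t + 2) →
        (Fin.snoc v x : Fin (t + 3) → Fin n) k ∉ A) ↔ ∀ k : Fin (t + 2), k ≠ 0 → v k ∉ A := by
      rw [Fin.forall_fin_succ']
      simp [Fin.castSucc_ne_last]
    have hstep : (∀ k : Fin (t + 2), G ((Fin.snoc v x : Fin (t + 3) → Fin n) k.castSucc)
        ((Fin.snoc v x : Fin (t + 3) → Fin n) k.succ) = 1) ↔
        (∀ k : Fin (t + 1), G (v k.castSucc) (v k.succ) = 1) ∧
          G (v (Fin.last (t + 1))) x = 1 := by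
      rw [Fin.forall_fin_succ']
      simp only [Fin.succ_castSucc, Fin.snoc_castSucc, Fin.succ_last, Fin.snoc_last]
    simp only [Fin.snocEquiv_apply, h0, havoid, hsplit, hstep, Fin.snoc_last]
    grind
  simp only [hw]
  rw [Finset.sum_eq_single b (by grind) (by simp),
    Finset.sum_eq_single (v (Fin.last (t + 1))) (by grind) (by simp)]
  rcases hG (v (Fin.last (t + 1))) b with h | h
  · simp [h]
  · simp [h]
    grind

/-- The matrix `x G` over `ℤ[[x]]`. -/
noncomputable def stepMatrix {n : ℕ} (G : Matrix (Fin n) (Fin n) ℤ) :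
    Matrix (Fin n) (Fin n) (PowerSeries ℤ) :=
  Matrix.of fun a b => PowerSeries.C (G a b) * PowerSeries.X

/-- The generating functions of the walks of positive length avoiding `A`. -/
noncomputable def excursionMatrix {n : ℕ} (G : Matrix (Fin n) (Fin n) ℤ) (A : Finset (Fin n)) :
    Matrix (Fin n) (Fin n) (PowerSeries ℤ) :=
  Matrix.of fun a b => PowerSeries.mk fun t => if t = 0 then 0 else (walkCountAvoid G A a b t : ℤ)

lemma excursionMatrix_apply_of_ne {n : ℕ} (G : Matrix (Fin n) (Fin n) ℤ) (A : Finset (Fin n))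
    {a b : Fin n} (hab : a ≠ b) : excursionMatrix G A a b = mAvoid G A a b := by
  ext t
  cases t <;> simp [excursionMatrix, mAvoid, walkCountAvoid_zero, hab]

/-- The diagonal projection onto the nodes in `A`. -/
noncomputable def nodeProj {n : ℕ} (A : Finset (Fin n)) :
    Matrix (Fin n) (Fin n) (PowerSeries ℤ) :=
  Matrix.diagonal fun c => if c ∈ A then 1 else 0

lemma excursionMatrix_eq {n : ℕ} {G : Matrix (Fin n) (Fin n) ℤ}
    (hG : ∀ i j, G i j = 0 ∨ G i j = 1) (A : Finset (Fin n)) :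
    excursionMatrix G A =
      stepMatrix G + excursionMatrix G A * ((1 - nodeProj A) * stepMatrix G) := by
  have hproj : (1 - nodeProj A) * stepMatrix G = Matrix.of fun c b =>
      PowerSeries.C ((if c ∈ A then 0 else 1) * G c b) * PowerSeries.X := by
    ext1 c b
    rw [nodeProj, ← Matrix.diagonal_one, Matrix.diagonal_sub, Matrix.diagonal_mul]
    by_cases hc : c ∈ A <;> simp [hc, stepMatrix]
  rw [hproj]
  ext a b t
  simp only [Matrix.add_apply, Matrix.mul_apply, map_add, map_sum,
    stepMatrix, Matrix.of_apply, ← mul_assoc]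
  rcases t with _ | _ | t
  · simp only [PowerSeries.coeff_zero_mul_X]
    simp [excursionMatrix]
  · simp only [PowerSeries.coeff_succ_mul_X, PowerSeries.coeff_C, PowerSeries.coeff_mul_C]
    simp [excursionMatrix, walkCountAvoid_one hG]
  · simp only [PowerSeries.coeff_succ_mul_X, PowerSeries.coeff_C, PowerSeries.coeff_mul_C]
    simp [excursionMatrix, walkCountAvoid_add_two hG]

lemma of_mSer_eq {n : ℕ} (G : Matrix (Fin n) (Fin n) ℤ) :
    Matrix.of (mSer G) = 1 + excursionMatrix G ∅ := by
  ext a b t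
  rcases t with _ | t
  · by_cases hab : a = b <;>
      simp [mSer, excursionMatrix, walkCount_eq_walkCountAvoid_empty, walkCountAvoid_zero, hab]
  · by_cases hab : a = b <;>
      simp [mSer, excursionMatrix, walkCount_eq_walkCountAvoid_empty, hab, PowerSeries.coeff_one]

lemma of_mSer_mul_one_sub {n : ℕ} {G : Matrix (Fin n) (Fin n) ℤ}
    (hG : ∀ i j, G i j = 0 ∨ G i j = 1) : Matrix.of (mSer G) * (1 - stepMatrix G) = 1 := by
  have h := excursionMatrix_eq hG ∅
  have h0 : (nodeProj ∅ : Matrix (Fin n) (Fin n) (PowerSeries ℤ)) = 0 := by simp [nodeProj]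
  rw [h0, sub_zero, one_mul] at h
  rw [of_mSer_eq, add_mul, one_mul, mul_sub, mul_one]
  nth_rw 1 [h]
  abel

lemma one_sub_mul_of_mSer {n : ℕ} {G : Matrix (Fin n) (Fin n) ℤ}
    (hG : ∀ i j, G i j = 0 ∨ G i j = 1) : (1 - stepMatrix G) * Matrix.of (mSer G) = 1 :=
  mul_eq_one_comm.mp (of_mSer_mul_one_sub hG)

lemma mSer_symm {n : ℕ} {G : Matrix (Fin n) (Fin n) ℤ}
    (hG : ∀ i j, G i j = 0 ∨ G i j = 1) (hsym : ∀ i j, G i j = G j i) (a b : Fin n) :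
    mSer G a b = mSer G b a := by
  have hstep : (stepMatrix G).transpose = stepMatrix G := by
    ext1 a b
    simp [stepMatrix, hsym a b]
  have h := congrArg Matrix.transpose (of_mSer_mul_one_sub hG)
  rw [Matrix.transpose_mul, Matrix.transpose_sub, Matrix.transpose_one, hstep] at h
  have hM := left_inv_eq_right_inv (of_mSer_mul_one_sub hG) h
  exact congrFun (congrFun hM a) b

/-- Renewal equation: a walk ending in `A` is decomposed at its first return to `A`. -/
lemma mSer_renewal {n : ℕ} {G : Matrix (Fin n) (Fin n) ℤ}
    (hG : ∀ i j, G i j = 0 ∨ G i j = 1) {A : Finset (Fin n)} (a : Fin n) {b : Fin n}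
    (hb : b ∈ A) :
    mSer G a b = (if a = b then 1 else 0) + ∑ s ∈ A, excursionMatrix G A a s * mSer G s b := by
  have hmatrix : excursionMatrix G A = Matrix.of (mSer G) - 1 -
      excursionMatrix G A * nodeProj A * Matrix.of (mSer G) +
      excursionMatrix G A * nodeProj A := by
    have hE := excursionMatrix_eq hG A
    have hM := one_sub_mul_of_mSer hG
    generalize excursionMatrix G A = E at *
    generalize Matrix.of (mSer G) = M at *
    generalize stepMatrix G = g at *
    generalize nodeProj A = P at *
    have hgM : g * M = M - 1 := by rw [sub_mul, one_mul] at hM; rw [← hM]; abel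
    have hE' : E * (1 - g) = g - E * P * g := by
      have : E - E * ((1 - P) * g) = g := sub_eq_of_eq_add hE
      calc E * (1 - g) = E - E * ((1 - P) * g) - E * P * g := by noncomm_ring
        _ = g - E * P * g := by rw [this]
    calc E = E * (1 - g) * M := by rw [mul_assoc, hM, mul_one]
      _ = g * M - E * P * (g * M) := by rw [hE']; noncomm_ring
      _ = _ := by rw [hgM]; noncomm_ring
  have h := congrFun (congrFun hmatrix a) b
  rw [Matrix.add_apply, Matrix.sub_apply, Matrix.sub_apply, Matrix.mul_apply] at h
  simp only [nodeProj, Matrix.mul_diagonal, Matrix.of_apply, hb, if_true, mul_one,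
    Matrix.one_apply, mul_ite, ite_mul, mul_zero, zero_mul, Finset.sum_ite_mem,
    Finset.univ_inter] at h
  linear_combination -h

/-- The intermediary formula: `m_{ij}^{¬{i,j,k}} · det M_{{i,j,k},{i,j,k}}
= m_{ij} m_{kk} − m_{ik} m_{jk}`. -/
theorem stmt13 {n : ℕ} (hn : 0 < n) (G : Matrix (Fin n) (Fin n) ℤ)
    (hG : ∀ i j, G i j = 0 ∨ G i j = 1) (hdiag : ∀ i, G i i = 0)
    (hsym : ∀ i j, G i j = G j i)
    (i j k : Fin n) (hij : i ≠ j) (hik : i ≠ k) (hjk : j ≠ k) :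
    mAvoid G {i, j, k} i j *
        (mSer G i i * mSer G j j * mSer G k k +
          2 * mSer G i j * mSer G i k * mSer G j k -
          mSer G i i * mSer G j k ^ 2 -
          mSer G i j ^ 2 * mSer G k k -
          mSer G i k ^ 2 * mSer G j j) =
      mSer G i j * mSer G k k - mSer G i k * mSer G j k := by
  have hsum (b : Fin n) : ∑ s ∈ {i, j, k}, excursionMatrix G {i, j, k} i s * mSer G s b =
      excursionMatrix G {i, j, k} i i * mSer G i b + excursionMatrix G {i, j, k} i j * mSer G j b +
        excursionMatrix G {i, j, k} i k * mSer G k b := by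
    rw [Finset.sum_insert (by simp [hij, hik]), Finset.sum_pair hjk, add_assoc]
  have hi := mSer_renewal hG (A := {i, j, k}) i (b := i) (by simp)
  have hj := mSer_renewal hG (A := {i, j, k}) i (b := j) (by simp)
  have hk := mSer_renewal hG (A := {i, j, k}) i (b := k) (by simp)
  rw [hsum, if_pos rfl, mSer_symm hG hsym j i, mSer_symm hG hsym k i] at hi
  rw [hsum, if_neg hij, mSer_symm hG hsym k j] at hj
  rw [hsum, if_neg hik] at hk
  rw [← excursionMatrix_apply_of_ne G _ hij]
  linear_combination
    (mSer G i j * mSer G k k - mSer G i k * mSer G j k) * hi -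
    (mSer G i i * mSer G k k - mSer G i k ^ 2) * hj +
    (mSer G i i * mSer G j k - mSer G i j * mSer G i k) * hk
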